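/- Let T ⊆ ℝ⁵ be the set of points (x, y, z₁, z₂, z₃) satisfying 0 ≤ x ≤ 1, 0 ≤ y ≤ 1, 2x ≤ z₁ < 1 + 2x, y ≤ z₁ < 1 + y, 7x ≤ z₂ < 1 + 7x, 5y ≤ z₂ < 1 + 5y, 4x ≤ z₃ < 1 + 4x, and 6y ≤ z₃ < 1 + 6y. Then the 5-dimensional Lebesgue measure (volume) of T equals 27251293/1564738560. -/

import Mathlib

open MeasureTheory

/-- The F-signature polytope for B_R((x²y⁴z⁷),(xy⁶z⁵)) (fan-ordered exponents
    a = (2,7,4), b = (1,5,6)): points (x, y, z₁, z₂, z₃) ∈ ℝ⁵ with 0 ≤ x ≤ 1, 0 ≤ y ≤ 1,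
    2x ≤ z₁ < 1+2x, y ≤ z₁ < 1+y, 7x ≤ z₂ < 1+7x, 5y ≤ z₂ < 1+5y,
    4x ≤ z₃ < 1+4x, 6y ≤ z₃ < 1+6y. -/
def T : Set (ℝ × ℝ × ℝ × ℝ × ℝ) :=
  {p | 0 ≤ p.1 ∧ p.1 ≤ 1 ∧ 0 ≤ p.2.1 ∧ p.2.1 ≤ 1 ∧
       2 * p.1 ≤ p.2.2.1 ∧ p.2.2.1 < 1 + 2 * p.1 ∧
       p.2.1 ≤ p.2.2.1 ∧ p.2.2.1 < 1 + p.2.1 ∧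
       7 * p.1 ≤ p.2.2.2.1 ∧ p.2.2.2.1 < 1 + 7 * p.1 ∧
       5 * p.2.1 ≤ p.2.2.2.1 ∧ p.2.2.2.1 < 1 + 5 * p.2.1 ∧
       4 * p.1 ≤ p.2.2.2.2 ∧ p.2.2.2.2 < 1 + 4 * p.1 ∧
       6 * p.2.1 ≤ p.2.2.2.2 ∧ p.2.2.2.2 < 1 + 6 * p.2.1}

namespace FSignature

lemma volume_Ico_inter_Ico_add_one (a b : ℝ) :
    volume {z : ℝ | a ≤ z ∧ z < 1 + a ∧ b ≤ z ∧ z < 1 + b} = ENNReal.ofReal (1 - |a - b|) := by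
  have h : {z : ℝ | a ≤ z ∧ z < 1 + a ∧ b ≤ z ∧ z < 1 + b} = Set.Ico (max a b) (1 + min a b) := by
    ext z
    simp only [Set.mem_ofPred_eq, Set.mem_Ico, max_le_iff, ← min_add_add_left, lt_min_iff]
    tauto
  rw [h, Real.volume_Ico, ← max_sub_min_eq_abs]
  congr 1
  rw [max_comm b a, min_comm b a]
  ring

/-- The signed density obtained by integrating out `z₁, z₂, z₃` over the slice above `(x, y)`. -/
def density (x y : ℝ) : ℝ :=
  (1 - |2 * x - y|) * (1 - |7 * x - 5 * y|) * (1 - |4 * x - 6 * y|)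

/-- The lower end of the `y`-range of the polytope above `x`. -/
noncomputable def lower (x : ℝ) : ℝ := max 0 ((7 * x - 1) / 5)

/-- The upper end of the `y`-range of the polytope above `x`. -/
noncomputable def upper (x : ℝ) : ℝ := (1 + 4 * x) / 6

lemma volume_fiber (x y : ℝ) :
    volume {z : ℝ × ℝ × ℝ | (2 * x ≤ z.1 ∧ z.1 < 1 + 2 * x ∧ y ≤ z.1 ∧ z.1 < 1 + y) ∧
      (7 * x ≤ z.2.1 ∧ z.2.1 < 1 + 7 * x ∧ 5 * y ≤ z.2.1 ∧ z.2.1 < 1 + 5 * y) ∧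
      (4 * x ≤ z.2.2 ∧ z.2.2 < 1 + 4 * x ∧ 6 * y ≤ z.2.2 ∧ z.2.2 < 1 + 6 * y)} =
    ENNReal.ofReal (1 - |2 * x - y|) * (ENNReal.ofReal (1 - |7 * x - 5 * y|) *
      ENNReal.ofReal (1 - |4 * x - 6 * y|)) := by
  simp only [← volume_Ico_inter_Ico_add_one]
  rw [← Measure.prod_prod, ← Measure.volume_eq_prod, ← Measure.prod_prod,
    ← Measure.volume_eq_prod]
  rfl

lemma measurableSet_T : MeasurableSet T := by
  unfold T
  measurability

lemma volume_slice (x y : ℝ) :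
    volume (Prod.mk y ⁻¹' (Prod.mk x ⁻¹' T)) =
      (Set.Icc (0 : ℝ) (1 / 2)).indicator (fun x => (Set.Icc (lower x) (upper x)).indicator
        (fun y => ENNReal.ofReal (density x y)) y) x := by
  by_cases hxy : (0 ≤ x ∧ x ≤ 1) ∧ 0 ≤ y ∧ y ≤ 1
  · have h : Prod.mk y ⁻¹' (Prod.mk x ⁻¹' T) =
        {z : ℝ × ℝ × ℝ | (2 * x ≤ z.1 ∧ z.1 < 1 + 2 * x ∧ y ≤ z.1 ∧ z.1 < 1 + y) ∧
        (7 * x ≤ z.2.1 ∧ z.2.1 < 1 + 7 * x ∧ 5 * y ≤ z.2.1 ∧ z.2.1 < 1 + 5 * y) ∧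
        (4 * x ≤ z.2.2 ∧ z.2.2 < 1 + 4 * x ∧ 6 * y ≤ z.2.2 ∧ z.2.2 < 1 + 6 * y)} := by
      ext z
      simp only [T, Set.mem_preimage, Set.mem_ofPred_eq]
      tauto
    rw [h, volume_fiber]
    obtain ⟨⟨hx0, hx1⟩, hy0, hy1⟩ := hxy
    by_cases h7 : 7 * x - 5 * y ≤ 1
    · by_cases h4 : 6 * y - 4 * x ≤ 1
      · have hx : x ∈ Set.Icc (0 : ℝ) (1 / 2) := ⟨hx0, by linarith⟩
        have hy : y ∈ Set.Icc (lower x) (upper x) :=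
          ⟨max_le hy0 (by linarith), by unfold upper; linarith⟩
        have e1 : 0 ≤ 1 - |2 * x - y| := by
          rw [sub_nonneg, abs_le]; constructor <;> linarith
        have e2 : 0 ≤ 1 - |7 * x - 5 * y| := by
          rw [sub_nonneg, abs_le]; constructor <;> linarith
        rw [Set.indicator_of_mem hx, Set.indicator_of_mem hy, density, mul_assoc,
          ENNReal.ofReal_mul e1, ENNReal.ofReal_mul e2]
      · have hy : y ∉ Set.Icc (lower x) (upper x) := by
          rintro ⟨-, h⟩
          unfold upper at h
          linarith
        have e : 1 - |4 * x - 6 * y| ≤ 0 := by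
          linarith [neg_abs_le (4 * x - 6 * y)]
        simp only [ENNReal.ofReal_of_nonpos e, mul_zero]
        rw [eq_comm, Set.indicator_apply_eq_zero]
        exact fun _ => Set.indicator_of_notMem hy _
    · have hy : y ∉ Set.Icc (lower x) (upper x) := by
        rintro ⟨h, -⟩
        linarith [(max_le_iff.1 h).2]
      have e : 1 - |7 * x - 5 * y| ≤ 0 := by
        linarith [le_abs_self (7 * x - 5 * y)]
      simp only [ENNReal.ofReal_of_nonpos e, mul_zero, zero_mul]
      rw [eq_comm, Set.indicator_apply_eq_zero]
      exact fun _ => Set.indicator_of_notMem hy _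
  · have h : Prod.mk y ⁻¹' (Prod.mk x ⁻¹' T) = ∅ := by
      ext z
      simp only [T, Set.mem_preimage, Set.mem_ofPred_eq, Set.mem_empty_iff_false, iff_false]
      tauto
    rw [h, measure_empty, eq_comm, Set.indicator_apply_eq_zero]
    refine fun hx => Set.indicator_of_notMem (fun hy => hxy ?_) _
    obtain ⟨hl, hu⟩ := hy
    have hl := max_le_iff.1 hl
    unfold upper at hu
    exact ⟨⟨hx.1, by linarith [hx.2]⟩, hl.1, by linarith [hx.2]⟩

lemma lower_le_upper {x : ℝ} (hx : x ∈ Set.Icc (0 : ℝ) (1 / 2)) : lower x ≤ upper x := by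
  obtain ⟨h0, h1⟩ := hx
  unfold lower upper
  exact max_le (by linarith) (by linarith)

lemma density_nonneg {x y : ℝ} (hx : x ∈ Set.Icc (0 : ℝ) (1 / 2))
    (hy : y ∈ Set.Icc (lower x) (upper x)) : 0 ≤ density x y := by
  obtain ⟨hx0, hx1⟩ := hx
  obtain ⟨hl, hu⟩ := hy
  obtain ⟨hl0, hl1⟩ := max_le_iff.1 hl
  unfold upper at hu
  refine mul_nonneg (mul_nonneg ?_ ?_) ?_ <;>
    (rw [sub_nonneg, abs_le]; constructor <;> linarith)

lemma continuous_density : Continuous (Function.uncurry density) := by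
  unfold Function.uncurry density
  fun_prop

lemma continuous_density_right (x : ℝ) : Continuous (density x) := by
  unfold density
  fun_prop

/-- The four-dimensional volume of the slice of the polytope at `x`, for `0 ≤ x ≤ 1 / 2`. -/
noncomputable def sliceVolume (x : ℝ) : ℝ := ∫ y in lower x..upper x, density x y

lemma continuous_sliceVolume : Continuous sliceVolume := by
  have h : sliceVolume = fun x =>
      (∫ y in (0 : ℝ)..upper x, density x y) - ∫ y in (0 : ℝ)..lower x, density x y := by
    ext x
    rw [intervalIntegral.integral_interval_sub_left] <;>
      first
      | rfl
      | exact (continuous_density_right x).intervalIntegrable _ _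
  have hl : Continuous lower := by unfold lower; fun_prop
  have hu : Continuous upper := by unfold upper; fun_prop
  rw [h]
  exact (intervalIntegral.continuous_parametric_intervalIntegral_of_continuous
    continuous_density hu).sub
    (intervalIntegral.continuous_parametric_intervalIntegral_of_continuous continuous_density hl)

lemma volume_T_eq : volume T = ENNReal.ofReal (∫ x in (0 : ℝ)..1 / 2, sliceVolume x) := by
  have inner (x : ℝ) : volume (Prod.mk x ⁻¹' T) =
      (Set.Icc (0 : ℝ) (1 / 2)).indicator (fun x => ENNReal.ofReal (sliceVolume x)) x := by
    rw [Measure.volume_eq_prod, Measure.prod_apply (measurable_prodMk_left measurableSet_T)]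
    simp only [volume_slice]
    by_cases hx : x ∈ Set.Icc (0 : ℝ) (1 / 2)
    · simp only [Set.indicator_of_mem hx]
      rw [lintegral_indicator measurableSet_Icc, sliceVolume,
        intervalIntegral.integral_of_le (lower_le_upper hx), ← integral_Icc_eq_integral_Ioc,
        ofReal_integral_eq_lintegral_ofReal
          (continuous_density_right x).continuousOn.integrableOn_Icc]
      exact (ae_restrict_iff' measurableSet_Icc).2 (.of_forall fun y hy => density_nonneg hx hy)
    · simp only [Set.indicator_of_notMem hx, lintegral_zero]
  rw [Measure.volume_eq_prod, Measure.prod_apply measurableSet_T]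
  simp only [inner]
  rw [lintegral_indicator measurableSet_Icc, intervalIntegral.integral_of_le (by norm_num),
    ← integral_Icc_eq_integral_Ioc, ofReal_integral_eq_lintegral_ofReal
      continuous_sliceVolume.continuousOn.integrableOn_Icc]
  refine (ae_restrict_iff' measurableSet_Icc).2 (.of_forall fun x hx => ?_)
  exact intervalIntegral.integral_nonneg (lower_le_upper hx) fun y hy => density_nonneg hx hy

/-- The antiderivative in `y`, vanishing at `0`, of the polynomial
`(1 - r (2x - y)) (1 - s (7x - 5y)) (1 - t (4x - 6y))`. -/
noncomputable def primitive (r s t x y : ℝ) : ℝ :=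
  (1 - 2 * r * x) * (1 - 7 * s * x) * (1 - 4 * t * x) * y +
  (r * (1 - 7 * s * x) * (1 - 4 * t * x) + 5 * s * (1 - 2 * r * x) * (1 - 4 * t * x) +
    6 * t * (1 - 2 * r * x) * (1 - 7 * s * x)) * y ^ 2 / 2 +
  (5 * r * s * (1 - 4 * t * x) + 6 * r * t * (1 - 7 * s * x) +
    30 * s * t * (1 - 2 * r * x)) * y ^ 3 / 3 +
  30 * r * s * t * y ^ 4 / 4

lemma hasDerivAt_primitive (r s t x y : ℝ) : HasDerivAt (primitive r s t x)
    ((1 - r * (2 * x - y)) * (1 - s * (7 * x - 5 * y)) * (1 - t * (4 * x - 6 * y))) y := by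
  unfold primitive
  have h (n : ℕ) := hasDerivAt_pow n y
  refine (((((hasDerivAt_id' y).const_mul _).add (((h 2).const_mul _).div_const 2)).add
    (((h 3).const_mul _).div_const 3)).add (((h 4).const_mul _).div_const 4)).congr_deriv ?_
  push_cast
  ring

lemma integral_density {r s t x p q : ℝ} (hpq : p ≤ q)
    (hr : ∀ y ∈ Set.Icc p q, |2 * x - y| = r * (2 * x - y))
    (hs : ∀ y ∈ Set.Icc p q, |7 * x - 5 * y| = s * (7 * x - 5 * y))
    (ht : ∀ y ∈ Set.Icc p q, |4 * x - 6 * y| = t * (4 * x - 6 * y)) :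
    ∫ y in p..q, density x y = primitive r s t x q - primitive r s t x p := by
  refine intervalIntegral.integral_eq_sub_of_hasDerivAt (fun y hy => ?_)
    ((continuous_density_right x).intervalIntegrable _ _)
  rw [Set.uIcc_of_le hpq] at hy
  rw [density, hr y hy, hs y hy, ht y hy]
  exact hasDerivAt_primitive r s t x y

lemma integral_density_of_le_two_thirds {x p q : ℝ} (hx : 0 ≤ x) (hpq : p ≤ q)
    (hq : q ≤ 2 * x / 3) :
    ∫ y in p..q, density x y = primitive 1 1 1 x q - primitive 1 1 1 x p := by
  refine integral_density hpq ?_ ?_ ?_ <;> rintro y ⟨-, h⟩ <;>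
    rw [one_mul, abs_of_nonneg (by linarith)]

lemma integral_density_of_le_seven_fifths {x p q : ℝ} (hx : 0 ≤ x) (hp : 2 * x / 3 ≤ p)
    (hpq : p ≤ q) (hq : q ≤ 7 * x / 5) :
    ∫ y in p..q, density x y = primitive 1 1 (-1) x q - primitive 1 1 (-1) x p := by
  refine integral_density hpq ?_ ?_ ?_ <;> rintro y ⟨h, h'⟩
  · rw [one_mul, abs_of_nonneg (by linarith)]
  · rw [one_mul, abs_of_nonneg (by linarith)]
  · rw [neg_one_mul, abs_of_nonpos (by linarith)]

lemma integral_density_of_le_two {x p q : ℝ} (hx : 0 ≤ x) (hp : 7 * x / 5 ≤ p)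
    (hpq : p ≤ q) (hq : q ≤ 2 * x) :
    ∫ y in p..q, density x y = primitive 1 (-1) (-1) x q - primitive 1 (-1) (-1) x p := by
  refine integral_density hpq ?_ ?_ ?_ <;> rintro y ⟨h, h'⟩
  · rw [one_mul, abs_of_nonneg (by linarith)]
  · rw [neg_one_mul, abs_of_nonpos (by linarith)]
  · rw [neg_one_mul, abs_of_nonpos (by linarith)]

lemma integral_density_of_two_le {x p q : ℝ} (hx : 0 ≤ x) (hp : 2 * x ≤ p) (hpq : p ≤ q) :
    ∫ y in p..q, density x y = primitive (-1) (-1) (-1) x q - primitive (-1) (-1) (-1) x p := by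
  refine integral_density hpq ?_ ?_ ?_ <;> rintro y ⟨h, -⟩ <;>
    rw [neg_one_mul, abs_of_nonpos (by linarith)]

lemma integral_density_split (x p q r : ℝ) :
    ∫ y in p..r, density x y = (∫ y in p..q, density x y) + ∫ y in q..r, density x y :=
  (intervalIntegral.integral_add_adjacent_intervals
    ((continuous_density_right x).intervalIntegrable _ _)
    ((continuous_density_right x).intervalIntegrable _ _)).symm

lemma lower_of_le {x : ℝ} (hx : x ≤ 1 / 7) : lower x = 0 := max_eq_left (by linarith)

lemma lower_of_ge {x : ℝ} (hx : 1 / 7 ≤ x) : lower x = (7 * x - 1) / 5 :=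
  max_eq_right (by linarith)

lemma sliceVolume_of_le_eighth {x : ℝ} (h0 : 0 ≤ x) (h1 : x ≤ 1 / 8) :
    sliceVolume x = 149 / 2592 + 671 / 648 * x + -1358 / 135 * x ^ 2 + 10253 / 405 * x ^ 3 +
      -165599 / 10125 * x ^ 4 := by
  rw [sliceVolume, lower_of_le (by linarith), upper, integral_density_split x _ (2 * x / 3),
    integral_density_split x (2 * x / 3) (7 * x / 5),
    integral_density_split x (7 * x / 5) (2 * x),
    integral_density_of_le_two_thirds, integral_density_of_le_seven_fifths,
    integral_density_of_le_two, integral_density_of_two_le]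
  · unfold primitive
    ring
  all_goals linarith

lemma sliceVolume_of_le_seventh {x : ℝ} (h0 : 1 / 8 ≤ x) (h1 : x ≤ 1 / 7) :
    sliceVolume x = 163 / 2592 + 589 / 648 * x + -1228 / 135 * x ^ 2 + 9373 / 405 * x ^ 3 +
      -60533 / 3375 * x ^ 4 := by
  rw [sliceVolume, lower_of_le (by linarith), upper, integral_density_split x _ (2 * x / 3),
    integral_density_split x (2 * x / 3) (7 * x / 5),
    integral_density_of_le_two_thirds, integral_density_of_le_seven_fifths,
    integral_density_of_le_two]
  · unfold primitive
    ring
  all_goals linarith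

lemma sliceVolume_of_le_five_div {x : ℝ} (h0 : 1 / 7 ≤ x) (h1 : x ≤ 5 / 22) :
    sliceVolume x = 38951 / 324000 + -9427 / 81000 * x + -9856 / 3375 * x ^ 2 +
      177023 / 20250 * x ^ 3 + -38599 / 6750 * x ^ 4 := by
  rw [sliceVolume, lower_of_ge (by linarith), upper, integral_density_split x _ (2 * x / 3),
    integral_density_split x (2 * x / 3) (7 * x / 5),
    integral_density_of_le_two_thirds, integral_density_of_le_seven_fifths,
    integral_density_of_le_two]
  · unfold primitive
    ring
  all_goals linarith

lemma sliceVolume_of_le_three_div {x : ℝ} (h0 : 5 / 22 ≤ x) (h1 : x ≤ 3 / 11) :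
    sliceVolume x = 55201 / 324000 + -66677 / 81000 * x + 1969 / 3375 * x ^ 2 +
      37873 / 20250 * x ^ 3 + -38599 / 20250 * x ^ 4 := by
  rw [sliceVolume, lower_of_ge (by linarith), upper, integral_density_split x _ (2 * x / 3),
    integral_density_of_le_two_thirds, integral_density_of_le_seven_fifths]
  · unfold primitive
    ring
  all_goals linarith

lemma sliceVolume_of_le_half {x : ℝ} (h0 : 3 / 11 ≤ x) (h1 : x ≤ 1 / 2) :
    sliceVolume x = 78529 / 324000 + -137093 / 81000 * x + 14641 / 3375 * x ^ 2 +
      -97163 / 20250 * x ^ 3 + 38599 / 20250 * x ^ 4 := by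
  rw [sliceVolume, lower_of_ge (by linarith), upper, integral_density_of_le_seven_fifths]
  · unfold primitive
    ring
  all_goals linarith

lemma integral_sliceVolume_of_eq {p q c₀ c₁ c₂ c₃ c₄ : ℝ} (hpq : p ≤ q)
    (h : ∀ {x : ℝ}, p ≤ x → x ≤ q →
      sliceVolume x = c₀ + c₁ * x + c₂ * x ^ 2 + c₃ * x ^ 3 + c₄ * x ^ 4) :
    ∫ x in p..q, sliceVolume x =
      (c₀ * q + c₁ * q ^ 2 / 2 + c₂ * q ^ 3 / 3 + c₃ * q ^ 4 / 4 + c₄ * q ^ 5 / 5) -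
      (c₀ * p + c₁ * p ^ 2 / 2 + c₂ * p ^ 3 / 3 + c₃ * p ^ 4 / 4 + c₄ * p ^ 5 / 5) := by
  refine intervalIntegral.integral_eq_sub_of_hasDerivAt
    (f := fun x => c₀ * x + c₁ * x ^ 2 / 2 + c₂ * x ^ 3 / 3 + c₃ * x ^ 4 / 4 + c₄ * x ^ 5 / 5)
    (fun x hx => ?_) (continuous_sliceVolume.intervalIntegrable _ _)
  rw [Set.uIcc_of_le hpq] at hx
  rw [h hx.1 hx.2]
  have hd (n : ℕ) (c : ℝ) := (hasDerivAt_pow n x).const_mul c |>.div_const n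
  refine ((((((hasDerivAt_id' x).const_mul c₀).add (hd 2 c₁)).add (hd 3 c₂)).add (hd 4 c₃)).add
    (hd 5 c₄)).congr_deriv ?_
  push_cast
  ring

lemma integral_sliceVolume_split (p q r : ℝ) :
    ∫ x in p..r, sliceVolume x = (∫ x in p..q, sliceVolume x) + ∫ x in q..r, sliceVolume x :=
  (intervalIntegral.integral_add_adjacent_intervals
    (continuous_sliceVolume.intervalIntegrable _ _)
    (continuous_sliceVolume.intervalIntegrable _ _)).symm

lemma integral_sliceVolume :
    ∫ x in (0 : ℝ)..1 / 2, sliceVolume x = 27251293 / 1564738560 := by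
  rw [integral_sliceVolume_split 0 (1 / 8), integral_sliceVolume_split (1 / 8) (1 / 7),
    integral_sliceVolume_split (1 / 7) (5 / 22), integral_sliceVolume_split (5 / 22) (3 / 11),
    integral_sliceVolume_of_eq (by norm_num) sliceVolume_of_le_eighth,
    integral_sliceVolume_of_eq (by norm_num) sliceVolume_of_le_seventh,
    integral_sliceVolume_of_eq (by norm_num) sliceVolume_of_le_five_div,
    integral_sliceVolume_of_eq (by norm_num) sliceVolume_of_le_three_div,
    integral_sliceVolume_of_eq (by norm_num) sliceVolume_of_le_half]
  norm_num

end FSignature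

/-- The volume of this F-signature polytope is 27251293/1564738560. -/
theorem fsig_volume : volume T = 27251293 / 1564738560 := by
  rw [FSignature.volume_T_eq, FSignature.integral_sliceVolume,
    ENNReal.ofReal_div_of_pos (by norm_num)]
  norm_num
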